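/- (Linear part of Kawashima's relation) For all w1, w2 ∈ yℌ, one has Z(φ(w1 ∗ w2) x) = 0. -/

import Mathlib

open scoped BigOperators

noncomputable section

/-- `ℌ = ℚ⟨x,y⟩`, the free noncommutative polynomial ring in two indeterminates,
realized as the free `ℚ`-algebra on `Bool` (`false ↦ x`, `true ↦ y`). -/
abbrev H : Type := FreeAlgebra ℚ Bool

/-- The indeterminate `x`. -/
def Hx : H := FreeAlgebra.ι ℚ false

/-- The indeterminate `y`. -/
def Hy : H := FreeAlgebra.ι ℚ true

/-- The multiple zeta value `ζ(k₁,…,k_r) = ∑_{0<n₁<⋯<n_r} 1/(n₁^{k₁}⋯n_r^{k_r})`. -/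
def MZV (r : ℕ) (k : Fin r → ℕ) : ℝ :=
  ∑' n : {n : Fin r → ℕ // (∀ i, 0 < n i) ∧ StrictMono n},
    ∏ i, (1 : ℝ) / (n.1 i : ℝ) ^ (k i)

/-- `Z : yℌx → ℝ` is the `ℚ`-linear map with `Z(y x^{k₁-1} ⋯ y x^{k_r-1}) = ζ(k₁,…,k_r)`.
We encode it as a `ℚ`-linear map on all of `ℌ` whose values on the basis monomials
`y x^{k₁-1} ⋯ y x^{k_r-1}` (with `k_r ≥ 2`) of `yℌx` are the multiple zeta values;
these values determine `Z` uniquely on the subspace `yℌx`. -/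
def IsZetaMap (Z : H →ₗ[ℚ] ℝ) : Prop :=
  ∀ (r : ℕ) (k : Fin (r + 1) → ℕ), (∀ i, 1 ≤ k i) → 2 ≤ k (Fin.last r) →
    Z ((List.ofFn fun i => Hy * Hx ^ (k i - 1)).prod) = MZV (r + 1) k

/-- The family `f(A,B) = (Z(A(x+y)^s B))_{s ≥ 0}`. -/
def fam (Z : H →ₗ[ℚ] ℝ) (A B : H) : ℕ → ℝ := fun s => Z (A * (Hx + Hy) ^ s * B)

/-- The `ℚ`-bilinear product `◇` on `ℌ`, characterized by its recursive defining
properties (which determine it uniquely). -/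
def IsDiamond (d : H →ₗ[ℚ] H →ₗ[ℚ] H) : Prop :=
  (∀ w, d w 1 = w) ∧ (∀ w, d 1 w = w) ∧
  (∀ w1 w2, d (Hx * w1) (Hx * w2) = Hx * d w1 (Hx * w2) - Hx * d (Hy * w1) w2) ∧
  (∀ w1 w2, d (Hx * w1) (Hy * w2) = Hx * d w1 (Hy * w2) + Hy * d (Hx * w1) w2) ∧
  (∀ w1 w2, d (Hy * w1) (Hx * w2) = Hy * d w1 (Hx * w2) + Hx * d (Hy * w1) w2) ∧
  (∀ w1 w2, d (Hy * w1) (Hy * w2) = Hy * d w1 (Hy * w2) - Hy * d (Hx * w1) w2)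

/-- The harmonic product `∗` on `ℌ`, characterized by its recursive defining
properties (which determine it uniquely). -/
def IsHarmonic (st : H →ₗ[ℚ] H →ₗ[ℚ] H) : Prop :=
  (∀ w, st w 1 = w) ∧ (∀ w, st 1 w = w) ∧
  (∀ w1 w2, st (Hx * w1) w2 = Hx * st w1 w2) ∧
  (∀ w1 w2, st w1 (Hx * w2) = Hx * st w1 w2) ∧
  (∀ w1 w2, st (Hy * w1) (Hy * w2) = Hy * (st w1 (Hy * w2) + st (Hy * w1) w2 + Hx * st w1 w2))

/-- The anti-automorphism `τ` of `ℌ` interchanging `x` and `y`, characterized by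
being `ℚ`-linear, anti-multiplicative, unital, and swapping the generators. -/
def IsTau (t : H →ₗ[ℚ] H) : Prop :=
  t 1 = 1 ∧ (∀ a b, t (a * b) = t b * t a) ∧ t Hx = Hy ∧ t Hy = Hx

/-- The automorphism `φ` of `ℌ` with `φ(x) = x + y` and `φ(y) = -y`. -/
def phi : H →ₐ[ℚ] H := FreeAlgebra.lift ℚ (fun b => if b then -Hy else Hx + Hy)

/-- The automorphism `S₁` of `ℌ` with `S₁(x) = x` and `S₁(y) = x + y`. -/
def S1 : H →ₐ[ℚ] H := FreeAlgebra.lift ℚ (fun b => if b then Hx + Hy else Hx)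

/-- The Dirichlet series `∑_{n ≥ 1} a_n / n^s` (with `a n` the coefficient indexed by
`n + 1`) converges to `L` at `s`, i.e. its partial sums tend to `L`. -/
def DSConv (a : ℕ → ℝ) (s : ℕ) (L : ℝ) : Prop :=
  Filter.Tendsto (fun N => ∑ n ∈ Finset.range N, a n / ((n : ℝ) + 1) ^ s)
    Filter.atTop (nhds L)


def opX : (ℕ → ℝ) →ₗ[ℚ] (ℕ → ℝ) where
  toFun f n := (∑ m ∈ Finset.range n, f (m + 1)) / n
  map_add' f g := by
    funext n; simp [Finset.sum_add_distrib, add_div]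
  map_smul' c f := by
    funext n; simp [Rat.smul_def, ← Finset.mul_sum, mul_div_assoc]

def opY : (ℕ → ℝ) →ₗ[ℚ] (ℕ → ℝ) where
  toFun f n := -(∑ m ∈ Finset.range n, f m) / n
  map_add' f g := by
    funext n; simp [Finset.sum_add_distrib]; ring
  map_smul' c f := by
    funext n; simp [Rat.smul_def, ← Finset.mul_sum]; ring

def rep : H →ₐ[ℚ] (Module.End ℚ (ℕ → ℝ))ᵐᵒᵖ :=
  FreeAlgebra.lift ℚ (fun b => MulOpposite.op (if b then opY else opX))

def dlt : ℕ → ℝ := fun n => if n = 0 then 1 else 0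

def aseq : H →ₗ[ℚ] (ℕ → ℝ) where
  toFun w := (rep w).unop dlt
  map_add' u v := by simp
  map_smul' c u := by simp

theorem aseq_one : aseq 1 = dlt := by simp [aseq]
theorem aseq_x (w : H) (n : ℕ) :
    aseq (w * Hx) n = (∑ m ∈ Finset.range n, aseq w (m + 1)) / n := by
  simp [aseq, rep, Hx, opX]
theorem aseq_y (w : H) (n : ℕ) :
    aseq (w * Hy) n = -(∑ m ∈ Finset.range n, aseq w m) / n := by
  simp [aseq, rep, Hy, opY]

theorem right_ind (p : Submodule ℚ H) (h1 : (1 : H) ∈ p) (hx : ∀ w ∈ p, w * Hx ∈ p)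
    (hy : ∀ w ∈ p, w * Hy ∈ p) (w : H) : w ∈ p := by
  have key : ∀ h : H, ∀ w ∈ p, w * h ∈ p := by
    intro h
    induction h using FreeAlgebra.induction with
    | grade0 r =>
      intro w hw
      rw [← Algebra.commutes, ← Algebra.smul_def]
      exact p.smul_mem _ hw
    | grade1 b =>
      intro w hw
      cases b
      · exact hx w hw
      · exact hy w hw
    | mul a b ha hb =>
      intro w hw
      rw [← mul_assoc]
      exact hb _ (ha _ hw)
    | add a b ha hb =>
      intro w hw
      rw [mul_add]
      exact p.add_mem (ha _ hw) (hb _ hw)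
  simpa using key w 1 h1

/-- iterated differences -/
def dl (f : ℕ → ℝ) : ℕ → ℕ → ℝ
  | 0, n => f n
  | N + 1, n => dl f N n - dl f N (n + 1)

theorem dl_succ (f : ℕ → ℝ) (N n : ℕ) : dl f (N + 1) n = dl f N n - dl f N (n + 1) := rfl

theorem dl_add (f g : ℕ → ℝ) (N n : ℕ) : dl (f + g) N n = dl f N n + dl g N n := by
  induction N generalizing n with
  | zero => rfl
  | succ N ih => simp only [dl_succ, ih]; ring

theorem dl_smul (c : ℚ) (f : ℕ → ℝ) (N n : ℕ) : dl (c • f) N n = c * dl f N n := by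
  induction N generalizing n with
  | zero => simp [dl, Rat.smul_def]
  | succ N ih => simp only [dl_succ, ih]; ring

theorem dl_rec (f g : ℕ → ℝ) (h : ∀ n : ℕ, f (n + 1) * (n + 1) - f n * n = g n) (N n : ℕ) :
    (N + 1) * dl f N (n + 1) - n * dl f (N + 1) n = dl g N n := by
  induction N generalizing n with
  | zero =>
    simp only [dl]
    rw [← h]; push_cast; ring
  | succ N ih =>
    have h1 := ih n
    have h2 := ih (n + 1)
    rw [dl_succ g, ← h1, ← h2]
    simp only [dl_succ]
    push_cast
    ring

theorem dl_shift (f : ℕ → ℝ) (N n : ℕ) : dl (fun n => f (n + 1)) N n = dl f N (n + 1) := by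
  induction N generalizing n with
  | zero => rfl
  | succ N ih => simp only [dl_succ, ih]

theorem dl_neg (f : ℕ → ℝ) (N n : ℕ) : dl (fun n => - f n) N n = - dl f N n := by
  induction N generalizing n with
  | zero => rfl
  | succ N ih => simp only [dl_succ, ih]; ring

theorem rec_x (w : H) (N n : ℕ) :
    (N + 1) * dl (aseq (w * Hx)) N (n + 1) - n * dl (aseq (w * Hx)) (N + 1) n
      = dl (aseq w) N (n + 1) := by
  rw [← dl_shift (aseq w)]
  apply dl_rec
  intro n
  rw [aseq_x, aseq_x, Finset.sum_range_succ]
  rcases Nat.eq_zero_or_pos n with rfl | h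
  · simp
  · push_cast
    field_simp
    ring

theorem rec_y (w : H) (N n : ℕ) :
    (N + 1) * dl (aseq (w * Hy)) N (n + 1) - n * dl (aseq (w * Hy)) (N + 1) n
      = - dl (aseq w) N n := by
  rw [← dl_neg]
  apply dl_rec
  intro n
  rw [aseq_y, aseq_y, Finset.sum_range_succ]
  rcases Nat.eq_zero_or_pos n with rfl | h
  · simp
  · push_cast
    field_simp
    ring

/-- weight m! N! / (m+N+1)! -/
def bt (m N : ℕ) : ℝ := (m.factorial * N.factorial : ℝ) / (m + N + 1).factorial

theorem bt_pos (m N : ℕ) : 0 < bt m N := by unfold bt; positivity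

theorem bt_zero (N : ℕ) : bt 0 N * (N + 1) = 1 := by
  unfold bt; simp [Nat.factorial_succ]; field_simp

theorem bt_step (m N : ℕ) : (m + 1 : ℝ) * bt m (N + 1) = (N + 1) * bt (m + 1) N := by
  unfold bt
  rw [show m + 1 + N + 1 = m + (N + 1) + 1 by ring]
  simp only [Nat.factorial_succ m, Nat.factorial_succ N]
  push_cast; ring

theorem bt_step2 (m N : ℕ) :
    bt m N = (N + 1) * bt (m + 1) N * (1 / (m + 1) + 1 / (N + 1)) := by
  unfold bt
  rw [show m + 1 + N + 1 = (m + N + 1) + 1 by ring]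
  simp only [Nat.factorial_succ m, Nat.factorial_succ (m + N + 1)]
  push_cast; field_simp; ring

theorem bt_le (m N : ℕ) : bt m N ≤ 1 / (m + N + 1) := by
  have h : (m.factorial * N.factorial : ℝ) ≤ (m + N).factorial := by
    exact_mod_cast Nat.le_of_dvd (Nat.factorial_pos _) (Nat.factorial_mul_factorial_dvd_factorial_add m N)
  unfold bt
  rw [Nat.factorial_succ, div_le_div_iff₀ (by positivity) (by positivity)]
  push_cast
  nlinarith

/-- harmonic numbers -/
def hr (n : ℕ) : ℝ := ∑ i ∈ Finset.range n, 1 / ((i : ℝ) + 1)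

theorem hr_succ (n : ℕ) : hr (n + 1) = hr n + 1 / ((n : ℝ) + 1) := Finset.sum_range_succ _ _
theorem hr_zero : hr 0 = 0 := rfl
theorem hr_mono : Monotone hr := by
  apply monotone_nat_of_le_succ
  intro n; rw [hr_succ]
  have : 0 < 1 / ((n : ℝ) + 1) := by positivity
  linarith
theorem hr_nonneg (n : ℕ) : 0 ≤ hr n := by rw [← hr_zero]; exact hr_mono (Nat.zero_le _)
theorem hr_one (n : ℕ) : 1 ≤ hr (n + 1) := by
  have := hr_mono (Nat.succ_le_succ (Nat.zero_le n))
  simpa [hr] using this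

def Good (f : ℕ → ℝ) : Prop :=
  ∃ (C : ℝ) (j : ℕ), 0 ≤ C ∧ ∀ N m : ℕ, |dl f N (m + 1)| ≤ C * hr (m + N + 1) ^ j * bt m N

theorem good_zero_bound {f : ℕ → ℝ} (hf : Good f) :
    ∃ (C : ℝ) (j : ℕ), 0 ≤ C ∧ ∀ N : ℕ, |dl f N 0| ≤ C * hr (N + 1) ^ j := by
  obtain ⟨C, j, hC, h⟩ := hf
  refine ⟨|f 0| + C, j + 1, by positivity, ?_⟩
  have key : ∀ N : ℕ, |dl f N 0| ≤ |f 0| + C * hr (N + 1) ^ j * hr N := by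
    intro N
    induction N with
    | zero => simp [dl, hr_zero]
    | succ N ih =>
      rw [dl_succ]
      have h1 := h N 0
      simp only [zero_add] at h1 ⊢
      have hb : bt 0 N = 1 / ((N : ℝ) + 1) := by
        rw [eq_div_iff (by positivity)]; exact bt_zero N
      rw [hb] at h1
      have h2 : hr (N + 1) ^ j ≤ hr (N + 1 + 1) ^ j :=
        pow_le_pow_left₀ (hr_nonneg _) (hr_mono (Nat.le_succ _)) _
      have h3 : C * hr (N + 1) ^ j * hr (N+1) ≤ C * hr (N + 1 + 1) ^ j * hr (N+1) := by
        have := hr_nonneg (N+1)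
        gcongr
      rw [hr_succ N] at h3
      have := abs_sub (dl f N 0) (dl f N 1)
      rw [hr_succ N]
      rw [hr_succ N] at *
      linarith
  intro N
  refine (key N).trans ?_
  have h1 := hr_one N
  have h2 : hr N ≤ hr (N+1) := hr_mono (Nat.le_succ _)
  have h3 : (1:ℝ) ≤ hr (N + 1) ^ (j+1) := one_le_pow₀ h1
  have h4 : C * hr (N + 1) ^ j * hr N ≤ C * hr (N + 1) ^ j * hr (N+1) := by
    have := hr_nonneg (N+1)
    gcongr
  have h5 := abs_nonneg (f 0)
  have h6 : C * hr (N + 1) ^ j * hr (N+1) = C * hr (N + 1) ^ (j+1) := by ring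
  nlinarith

theorem good_add {f g : ℕ → ℝ} (hf : Good f) (hg : Good g) : Good (f + g) := by
  obtain ⟨C, j, hC, h⟩ := hf
  obtain ⟨C', j', hC', h'⟩ := hg
  refine ⟨C + C', j + j', by positivity, fun N m => ?_⟩
  rw [dl_add]
  refine (abs_add_le _ _).trans ((add_le_add (h N m) (h' N m)).trans ?_)
  have hb := (bt_pos m N).le
  have h1 := hr_one (m + N)
  rw [add_mul, add_mul]
  gcongr <;> omega

theorem good_smul (c : ℚ) {f : ℕ → ℝ} (hf : Good f) : Good (c • f) := by
  obtain ⟨C, j, hC, h⟩ := hf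
  refine ⟨|(c : ℝ)| * C, j, by positivity, fun N m => ?_⟩
  rw [dl_smul, abs_mul, mul_assoc, mul_assoc]
  gcongr
  rw [← mul_assoc]; exact h N m

theorem good_one : Good (aseq 1) := by
  refine ⟨0, 0, le_rfl, fun N m => ?_⟩
  have : dl (aseq 1) N (m + 1) = 0 := by
    induction N generalizing m with
    | zero => simp [dl, aseq_one, dlt]
    | succ N ih => rw [dl_succ, ih, ih, sub_zero]
  simp [this]

theorem good_x (w : H) (hf : Good (aseq w)) : Good (aseq (w * Hx)) := by
  obtain ⟨C, j, hC, h⟩ := hf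
  refine ⟨C, j + 1, hC, ?_⟩
  have key : ∀ m N : ℕ, |dl (aseq (w * Hx)) N (m + 1)| ≤
      C * hr (m + N + 1) ^ j * (hr (m + N + 1) - hr N) * bt m N := by
    intro m
    induction m with
    | zero =>
      intro N
      have h1 := rec_x w N 0
      have h2 := h N 0
      rw [← h1] at h2
      have hN : (0 : ℝ) < N + 1 := by positivity
      simp only [Nat.cast_zero, zero_mul, sub_zero, zero_add, abs_mul, abs_of_pos hN] at h2 ⊢
      have e : hr (N + 1) - hr N = 1 / ((N:ℝ) + 1) := by rw [hr_succ]; ring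
      rw [e]
      calc _ = ((N + 1 : ℝ) * |dl (aseq (w * Hx)) N 1|) / (N + 1) := by field_simp
        _ ≤ (C * hr (N + 1) ^ j * bt 0 N) / (N + 1) := by gcongr
        _ = _ := by ring
    | succ m ih =>
      intro N
      have h1 := rec_x w N (m + 1)
      have h2 := h N (m + 1)
      have h3 := ih (N + 1)
      have hN : (0 : ℝ) < N + 1 := by positivity
      have e : dl (aseq (w * Hx)) N (m + 1 + 1) = (dl (aseq w) N (m + 1 + 1) +
        (m + 1) * dl (aseq (w * Hx)) (N + 1) (m + 1)) / (N + 1) := by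
        rw [← h1]; push_cast; field_simp; ring
      rw [e, abs_div, abs_of_pos hN, div_le_iff₀ hN]
      refine (abs_add_le _ _).trans ?_
      rw [abs_mul, abs_of_pos (by positivity : (0:ℝ) < m + 1)]
      have h4 : ((m:ℝ) + 1) * |dl (aseq (w * Hx)) (N + 1) (m + 1)| ≤
        (m + 1) * (C * hr (m + (N + 1) + 1) ^ j * (hr (m + (N + 1) + 1) - hr (N + 1)) * bt m (N + 1)) := by
        gcongr
      have e2 := bt_step m N
      have e3 : m + (N + 1) + 1 = m + 1 + N + 1 := by ring
      rw [e3] at h4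
      calc _ ≤ C * hr (m + 1 + N + 1) ^ j * bt (m + 1) N + (m + 1) * (C * hr (m + 1 + N + 1) ^ j * (hr (m + 1 + N + 1) - hr (N + 1)) * bt m (N + 1)) := add_le_add h2 h4
        _ = C * hr (m + 1 + N + 1) ^ j * bt (m + 1) N + (C * hr (m + 1 + N + 1) ^ j * (hr (m + 1 + N + 1) - hr (N + 1)) * ((m + 1) * bt m (N + 1))) := by ring
        _ = _ := by
          rw [e2, hr_succ N]; field_simp; ring
  intro N m
  refine (key m N).trans ?_
  have hb := (bt_pos m N).le
  have h1 := hr_nonneg (m + N + 1)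
  have h2 := hr_nonneg N
  rw [pow_succ, ← mul_assoc]
  gcongr
  linarith

theorem good_y (w : H) (hf : Good (aseq w)) : Good (aseq (w * Hy)) := by
  obtain ⟨C0, j0, hC0, h0⟩ := good_zero_bound hf
  obtain ⟨C1, j1, hC1, h1⟩ := hf
  obtain ⟨C, j, hC, h, hz⟩ : ∃ (C : ℝ) (j : ℕ), 0 ≤ C ∧
      (∀ N m : ℕ, |dl (aseq w) N (m + 1)| ≤ C * hr (m + 1 + N + 1) ^ j * bt m N) ∧
      (∀ N : ℕ, |dl (aseq w) N 0| ≤ C * hr (N + 1) ^ j) := by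
    refine ⟨C0 + C1, j0 + j1, by positivity, fun N m => (h1 N m).trans ?_, fun N => (h0 N).trans ?_⟩
    · have hb := (bt_pos m N).le
      have t1 := hr_one (m + N)
      have t2 : hr (m + N + 1) ≤ hr (m + 1 + N + 1) := hr_mono (by omega)
      have t3 : hr (m + N + 1) ^ j1 ≤ hr (m + 1 + N + 1) ^ (j0 + j1) :=
        (pow_le_pow_left₀ (by linarith) t2 _).trans (pow_le_pow_right₀ (by linarith) (by omega))
      have := hr_nonneg (m + N + 1)
      gcongr
      linarith
    · have t1 := hr_one N
      gcongr
      · linarith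
      · omega
  refine ⟨C * 3, j + 1, by positivity, ?_⟩
  have key : ∀ m N : ℕ, |dl (aseq (w * Hy)) N (m + 1)| ≤
      C * hr (m + N + 1) ^ j * (1 + hr m + hr (m + N + 1) - hr N) * bt m N := by
    intro m
    induction m with
    | zero =>
      intro N
      have h1 := rec_y w N 0
      have h2 := hz N
      rw [← abs_neg, ← h1] at h2
      have hN : (0 : ℝ) < N + 1 := by positivity
      simp only [Nat.cast_zero, zero_mul, sub_zero, zero_add, abs_mul, abs_of_pos hN, hr_zero, add_zero] at h2 ⊢
      have hb : bt 0 N = 1 / ((N : ℝ) + 1) := by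
        rw [eq_div_iff (by positivity)]; exact bt_zero N
      have e : hr N ≤ hr (N + 1) := hr_mono (Nat.le_succ _)
      have e' := hr_nonneg (N+1)
      rw [hb]
      calc _ = ((N + 1 : ℝ) * |dl (aseq (w * Hy)) N 1|) / (N + 1) := by field_simp
        _ ≤ (C * hr (N + 1) ^ j) / (N + 1) := by gcongr
        _ = C * hr (N + 1) ^ j * 1 * (1 / (N + 1)) := by ring
        _ ≤ _ := by
          gcongr
          linarith
    | succ m ih =>
      intro N
      have h1 := rec_y w N (m + 1)
      have h2 := h N m
      have h3 := ih (N + 1)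
      have hN : (0 : ℝ) < N + 1 := by positivity
      have e : dl (aseq (w * Hy)) N (m + 1 + 1) = (-dl (aseq w) N (m + 1) +
        (m + 1) * dl (aseq (w * Hy)) (N + 1) (m + 1)) / (N + 1) := by
        rw [← h1]; push_cast; field_simp; ring
      rw [e, abs_div, abs_of_pos hN, div_le_iff₀ hN]
      refine (abs_add_le _ _).trans ?_
      rw [abs_mul, abs_of_pos (by positivity : (0:ℝ) < m + 1), abs_neg]
      have h4 : ((m:ℝ) + 1) * |dl (aseq (w * Hy)) (N + 1) (m + 1)| ≤
        (m + 1) * (C * hr (m + (N + 1) + 1) ^ j * (1 + hr m + hr (m + (N + 1) + 1) - hr (N + 1)) * bt m (N + 1)) := by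
        gcongr
      have e2 := bt_step m N
      have e3 : m + (N + 1) + 1 = m + 1 + N + 1 := by ring
      rw [e3] at h4
      rw [bt_step2] at h2
      calc _ ≤ _ := add_le_add h2 h4
        _ = C * hr (m + 1 + N + 1) ^ j * ((N + 1) * bt (m + 1) N * (1 / (m + 1) + 1 / (N + 1))) + (C * hr (m + 1 + N + 1) ^ j * (1 + hr m + hr (m + 1 + N + 1) - hr (N + 1)) * ((m + 1) * bt m (N + 1))) := by ring
        _ = _ := by
          rw [e2, hr_succ N, hr_succ m]; field_simp; ring
  intro N m
  refine (key m N).trans ?_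
  have hb := (bt_pos m N).le
  have h1 := hr_nonneg (m + N + 1)
  have h2 := hr_nonneg N
  have h3 := hr_one (m + N)
  have h4 : hr m ≤ hr (m + N + 1) := hr_mono (by omega)
  have e : C * 3 * hr (m + N + 1) ^ (j + 1) = C * hr (m + N + 1) ^ j * (3 * hr (m + N + 1)) := by ring
  rw [e]
  gcongr
  linarith

theorem good_all (w : H) : Good (aseq w) := by
  let p : Submodule ℚ H :=
    { carrier := {w | Good (aseq w)}
      add_mem' := fun {a b} ha hb => by
        simp only [Set.mem_ofPred_eq, map_add] at *
        exact good_add ha hb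
      zero_mem' := ⟨0, 0, le_rfl, fun N m => by
        have := dl_smul 0 0 N (m + 1)
        simp at this
        simp [this]⟩
      smul_mem' := fun c a ha => by
        simp only [Set.mem_ofPred_eq, map_smul] at *
        exact good_smul c ha }
  exact right_ind p good_one good_x good_y w
theorem hr_le_log (n : ℕ) : hr (n + 1) ≤ 1 + Real.log ((n : ℝ) + 1) := by
  have h := harmonic_le_one_add_log (n + 1)
  have e : ((harmonic (n + 1) : ℚ) : ℝ) = hr (n + 1) := by
    simp [harmonic, hr]
  rw [e] at h
  simpa using h

theorem hr_pow_le (j : ℕ) : ∃ K : ℝ, 0 ≤ K ∧ ∀ n : ℕ,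
    hr (n + 1) ^ j ≤ K * ((n : ℝ) + 1) ^ (1 / 4 : ℝ) := by
  set d : ℝ := 1 / (4 * (j + 1)) with hd
  have hdpos : 0 < d := by positivity
  refine ⟨(1 + 1 / d) ^ j, by positivity, fun n => ?_⟩
  have hn : (1 : ℝ) ≤ (n : ℝ) + 1 := by linarith [Nat.cast_nonneg (α := ℝ) n]
  have h1 : hr (n + 1) ≤ (1 + 1 / d) * ((n : ℝ) + 1) ^ d := by
    have h2 := Real.log_le_rpow_div (by linarith : (0 : ℝ) ≤ (n : ℝ) + 1) hdpos
    have h3 : (1 : ℝ) ≤ ((n : ℝ) + 1) ^ d := Real.one_le_rpow hn hdpos.le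
    have h4 := hr_le_log n
    calc _ ≤ 1 + ((n : ℝ) + 1) ^ d / d := by linarith
      _ ≤ ((n : ℝ) + 1) ^ d + ((n : ℝ) + 1) ^ d / d := by linarith
      _ = _ := by ring
  calc hr (n + 1) ^ j ≤ ((1 + 1 / d) * ((n : ℝ) + 1) ^ d) ^ j :=
        pow_le_pow_left₀ (hr_nonneg _) h1 _
    _ = (1 + 1 / d) ^ j * ((n : ℝ) + 1) ^ (d * j) := by
        rw [mul_pow, Real.rpow_mul (by linarith), Real.rpow_natCast]
    _ ≤ _ := by
        gcongr
        · rw [hd, div_mul_eq_mul_div, one_mul, div_le_div_iff₀ (by positivity) (by norm_num)]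
          linarith

/-- Polynomial version of the bounds. -/
theorem bound1 (w : H) : ∃ K : ℝ, 0 ≤ K ∧ ∀ N m : ℕ,
    |dl (aseq w) N (m + 1)| ≤ K * ((m : ℝ) + N + 1) ^ (-(3 / 4) : ℝ) := by
  obtain ⟨C, j, hC, h⟩ := good_all w
  obtain ⟨K, hK, hh⟩ := hr_pow_le j
  refine ⟨C * K, by positivity, fun N m => (h N m).trans ?_⟩
  have h1 := hh (m + N)
  push_cast at h1
  have h2 := bt_le m N
  have hp : (0 : ℝ) < (m : ℝ) + N + 1 := by positivity
  have e : ((m : ℝ) + N + 1) ^ (-(3 / 4) : ℝ) =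
      ((m : ℝ) + N + 1) ^ (1 / 4 : ℝ) * (1 / ((m : ℝ) + N + 1)) := by
    rw [one_div ((m : ℝ) + N + 1), ← Real.rpow_neg_one, ← Real.rpow_add hp]; norm_num
  have := (bt_pos m N).le
  rw [e]
  calc _ ≤ C * (K * ((m : ℝ) + N + 1) ^ (1 / 4 : ℝ)) * (1 / ((m : ℝ) + N + 1)) := by gcongr
    _ = _ := by ring

theorem bound0 (w : H) : ∃ K : ℝ, 0 ≤ K ∧ ∀ N : ℕ,
    |dl (aseq w) N 0| ≤ K * ((N : ℝ) + 1) ^ (1 / 4 : ℝ) := by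
  obtain ⟨C, j, hC, h⟩ := good_zero_bound (good_all w)
  obtain ⟨K, hK, hh⟩ := hr_pow_le j
  refine ⟨C * K, by positivity, fun N => (h N).trans ?_⟩
  rw [mul_assoc]
  gcongr
  exact hh N

theorem bound2 (w : H) : ∃ K : ℝ, 0 ≤ K ∧ ∀ N m : ℕ,
    |dl (aseq w) N (m + 1) / ((m : ℝ) + 1)| ≤
      K * ((N : ℝ) + 1) ^ (-(1 / 2) : ℝ) * ((m : ℝ) + 1) ^ (-(5 / 4) : ℝ) := by
  obtain ⟨K, hK, h⟩ := bound1 w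
  refine ⟨K, hK, fun N m => ?_⟩
  have hm : (0 : ℝ) < (m : ℝ) + 1 := by positivity
  have hN : (0 : ℝ) < (N : ℝ) + 1 := by positivity
  have hp : (0 : ℝ) < (m : ℝ) + N + 1 := by positivity
  rw [abs_div, abs_of_pos hm]
  have e1 : ((m : ℝ) + N + 1) ^ (-(3 / 4) : ℝ) =
      ((m : ℝ) + N + 1) ^ (-(1 / 2) : ℝ) * ((m : ℝ) + N + 1) ^ (-(1 / 4) : ℝ) := by
    rw [← Real.rpow_add hp]; norm_num
  have e2 : ((m : ℝ) + 1) ^ (-(5 / 4) : ℝ) =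
      ((m : ℝ) + 1) ^ (-(1 / 4) : ℝ) * (1 / ((m : ℝ) + 1)) := by
    rw [one_div ((m : ℝ) + 1), ← Real.rpow_neg_one, ← Real.rpow_add hm]; norm_num
  have h1 : ((m : ℝ) + N + 1) ^ (-(1 / 2) : ℝ) ≤ ((N : ℝ) + 1) ^ (-(1 / 2) : ℝ) :=
    Real.rpow_le_rpow_of_nonpos hN (by linarith [Nat.cast_nonneg (α := ℝ) m]) (by norm_num)
  have h2 : ((m : ℝ) + N + 1) ^ (-(1 / 4) : ℝ) ≤ ((m : ℝ) + 1) ^ (-(1 / 4) : ℝ) :=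
    Real.rpow_le_rpow_of_nonpos hm (by linarith [Nat.cast_nonneg (α := ℝ) N]) (by norm_num)
  calc _ ≤ K * ((m : ℝ) + N + 1) ^ (-(3 / 4) : ℝ) / ((m : ℝ) + 1) := by
        gcongr; exact h N m
    _ ≤ K * (((N : ℝ) + 1) ^ (-(1 / 2) : ℝ) * ((m : ℝ) + 1) ^ (-(1 / 4) : ℝ)) / ((m : ℝ) + 1) := by
        rw [e1]; gcongr
    _ = _ := by rw [e2]; ring

theorem summ54 : Summable (fun m : ℕ => ((m : ℝ) + 1) ^ (-(5 / 4) : ℝ)) := by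
  have h := (Real.summable_nat_rpow (p := -(5 / 4))).2 (by norm_num)
  simpa using (summable_nat_add_iff 1).2 h

theorem summ1 (w : H) (N : ℕ) : Summable (fun m : ℕ => dl (aseq w) N (m + 1) / ((m : ℝ) + 1)) := by
  obtain ⟨K, hK, h⟩ := bound2 w
  exact Summable.of_norm_bounded (summ54.mul_left _) (fun m => h N m)

theorem lim1 (w : H) (N : ℕ) :
    Filter.Tendsto (fun m : ℕ => dl (aseq w) N (m + 1)) Filter.atTop (nhds 0) := by
  obtain ⟨K, hK, h⟩ := bound1 w
  refine squeeze_zero_norm (a := fun m : ℕ => K * ((m : ℝ) + N + 1) ^ (-(3 / 4) : ℝ)) (fun m => h N m) ?_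
  rw [← mul_zero K]
  apply Filter.Tendsto.const_mul
  apply (tendsto_rpow_neg_atTop (by norm_num : (0 : ℝ) < 3 / 4)).comp
  have : (fun m : ℕ => (m : ℝ) + N + 1) = fun m : ℕ => (((m + (N + 1) : ℕ)) : ℝ) := by
    funext m; push_cast; ring
  rw [this]
  exact tendsto_natCast_atTop_atTop.comp (Filter.tendsto_add_atTop_nat _)

/-- the interpolated value -/
def AA (w : H) (N : ℕ) : ℝ := dl (aseq w) N 0
/-- its derivative -/
def DD (w : H) (N : ℕ) : ℝ := -∑' m : ℕ, dl (aseq w) N (m + 1) / ((m : ℝ) + 1)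

theorem AA_add (u v : H) (N : ℕ) : AA (u + v) N = AA u N + AA v N := by
  simp [AA, dl_add]
theorem AA_smul (c : ℚ) (v : H) (N : ℕ) : AA (c • v) N = c * AA v N := by
  simp [AA, dl_smul]
theorem DD_add (u v : H) (N : ℕ) : DD (u + v) N = DD u N + DD v N := by
  simp only [DD, map_add, dl_add, add_div]
  rw [(summ1 u N).tsum_add (summ1 v N)]; ring
theorem DD_smul (c : ℚ) (v : H) (N : ℕ) : DD (c • v) N = c * DD v N := by
  simp only [DD, map_smul, dl_smul, mul_div_assoc]
  rw [tsum_mul_left]; ring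

theorem AA_diff (w : H) (N : ℕ) : AA w (N + 1) - AA w N = - dl (aseq w) N 1 := by
  simp [AA, dl_succ]

theorem summ2 (w : H) (N : ℕ) : Summable (fun m : ℕ => dl (aseq w) N (m + 2) / ((m : ℝ) + 1)) := by
  refine ((summ1 w N).sub (summ1 w (N + 1))).congr (fun m => ?_)
  rw [dl_succ]; ring

theorem DD_diff (w : H) (N : ℕ) :
    DD w (N + 1) - DD w N = ∑' m : ℕ, dl (aseq w) N (m + 2) / ((m : ℝ) + 1) := by
  have : (fun m : ℕ => dl (aseq w) N (m + 2) / ((m : ℝ) + 1)) = fun m : ℕ =>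
      dl (aseq w) N (m + 1) / ((m : ℝ) + 1) - dl (aseq w) (N + 1) (m + 1) / ((m : ℝ) + 1) := by
    funext m; rw [dl_succ]; ring
  rw [this, (summ1 w N).tsum_sub (summ1 w (N + 1))]
  simp only [DD]; ring

theorem tele (w : H) (N : ℕ) (hs : Summable (fun m : ℕ => dl (aseq w) (N + 1) (m + 1))) :
    ∑' m : ℕ, dl (aseq w) (N + 1) (m + 1) = dl (aseq w) N 1 := by
  have h1 := hs.hasSum.tendsto_sum_nat
  have h2 : ∀ M : ℕ, ∑ m ∈ Finset.range M, dl (aseq w) (N + 1) (m + 1)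
      = dl (aseq w) N 1 - dl (aseq w) N (M + 1) := by
    intro M
    induction M with
    | zero => simp
    | succ M ih => rw [Finset.sum_range_succ, ih, dl_succ]; ring
  simp only [h2] at h1
  have h3 := (lim1 w N).const_sub (dl (aseq w) N 1)
  rw [sub_zero] at h3
  exact tendsto_nhds_unique h1 h3

theorem DD_x (w : H) (N : ℕ) :
    (N + 1) * (DD (w * Hx) (N + 1) - DD (w * Hx) N)
      = (DD w (N + 1) - DD w N) + dl (aseq (w * Hx)) N 1 := by
  have e : ∀ m : ℕ, dl (aseq (w * Hx)) (N + 1) (m + 1) =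
      (N + 1) * (dl (aseq (w * Hx)) N (m + 2) / ((m : ℝ) + 1)) -
        dl (aseq w) N (m + 2) / ((m : ℝ) + 1) := by
    intro m
    have h := rec_x w N (m + 1)
    rw [← h]; push_cast; field_simp; ring
  have hs := ((summ2 (w * Hx) N).mul_left ((N : ℝ) + 1)).sub (summ2 w N)
  have ht := tele (w * Hx) N (hs.congr (fun m => (e m).symm))
  rw [DD_diff, DD_diff, ← ht, tsum_congr e,
    ((summ2 (w * Hx) N).mul_left ((N : ℝ) + 1)).tsum_sub (summ2 w N), tsum_mul_left]
  ring

theorem DD_y (w : H) (N : ℕ) :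
    (N + 1) * (DD (w * Hy) (N + 1) - DD (w * Hy) N)
      = DD w N + dl (aseq (w * Hy)) N 1 := by
  have e : ∀ m : ℕ, dl (aseq (w * Hy)) (N + 1) (m + 1) =
      (N + 1) * (dl (aseq (w * Hy)) N (m + 2) / ((m : ℝ) + 1)) +
        dl (aseq w) N (m + 1) / ((m : ℝ) + 1) := by
    intro m
    have h := rec_y w N (m + 1)
    rw [← neg_eq_iff_eq_neg] at h
    rw [← h]; push_cast; field_simp; ring
  have hs := ((summ2 (w * Hy) N).mul_left ((N : ℝ) + 1)).add (summ1 w N)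
  have ht := tele (w * Hy) N (hs.congr (fun m => (e m).symm))
  rw [DD_diff, ← ht, tsum_congr e,
    ((summ2 (w * Hy) N).mul_left ((N : ℝ) + 1)).tsum_add (summ1 w N), tsum_mul_left, DD]
  ring

def BB (w : H) (N : ℕ) : DualNumber ℝ := (AA w N, DD w N)
def gg (N : ℕ) : DualNumber ℝ := (1 / ((N : ℝ) + 1), - (1 / ((N : ℝ) + 1) ^ 2))

@[simp] theorem BB_fst (w : H) (N : ℕ) : (BB w N).fst = AA w N := rfl
@[simp] theorem BB_snd (w : H) (N : ℕ) : (BB w N).snd = DD w N := rfl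
@[simp] theorem gg_fst (N : ℕ) : (gg N).fst = 1 / ((N : ℝ) + 1) := rfl
@[simp] theorem gg_snd (N : ℕ) : (gg N).snd = - (1 / ((N : ℝ) + 1) ^ 2) := rfl

theorem BB_add (u v : H) (N : ℕ) : BB (u + v) N = BB u N + BB v N := by
  ext <;> simp [AA_add, DD_add]

theorem BB_x (w : H) (N : ℕ) :
    BB (w * Hx) (N + 1) - BB (w * Hx) N = gg N * (BB w (N + 1) - BB w N) := by
  have h := rec_x w N 0
  have h2 := DD_x w N
  have hN : (0 : ℝ) < N + 1 := by positivity
  simp only [Nat.cast_zero, zero_mul, sub_zero, zero_add] at h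
  ext
  · simp only [TrivSqZeroExt.fst_sub, TrivSqZeroExt.fst_mul, BB_fst, gg_fst, AA_diff]
    rw [← h]; field_simp
  · simp only [TrivSqZeroExt.fst_sub, TrivSqZeroExt.snd_sub, TrivSqZeroExt.snd_mul, BB_fst, gg_fst,
      BB_snd, gg_snd, AA_diff, smul_eq_mul, op_smul_eq_mul]
    rw [← h, ← sub_eq_iff_eq_add.2 h2]; field_simp; ring

theorem BB_y (w : H) (N : ℕ) :
    BB (w * Hy) (N + 1) - BB (w * Hy) N = gg N * BB w N := by
  have h := rec_y w N 0
  have h2 := DD_y w N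
  have hN : (0 : ℝ) < N + 1 := by positivity
  simp only [Nat.cast_zero, zero_mul, sub_zero, zero_add] at h
  rw [← neg_eq_iff_eq_neg] at h
  ext
  · simp only [TrivSqZeroExt.fst_sub, TrivSqZeroExt.fst_mul, BB_fst, gg_fst, AA_diff]
    rw [AA, ← h]; field_simp
  · simp only [TrivSqZeroExt.snd_sub, TrivSqZeroExt.snd_mul, BB_fst, gg_fst,
      BB_snd, gg_snd, smul_eq_mul, op_smul_eq_mul]
    rw [AA, ← h, ← sub_eq_iff_eq_add.2 h2]; field_simp; ring

def zk (k : ℕ) : H := Hy * Hx ^ k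

theorem zk_succ (k : ℕ) : zk (k + 1) = zk k * Hx := by
  rw [zk, zk, pow_succ, mul_assoc]

theorem BB_z (w : H) (k N : ℕ) :
    BB (w * zk k) (N + 1) = BB (w * zk k) N + gg N ^ (k + 1) * BB w N := by
  rw [← sub_eq_iff_eq_add']
  induction k with
  | zero => simp [zk, BB_y]
  | succ k ih => rw [zk_succ, ← mul_assoc, BB_x, ih]; ring

theorem AA_z_zero (w : H) (k : ℕ) : AA (w * zk k) 0 = 0 := by
  cases k with
  | zero => simp [AA, dl, zk, aseq_y]
  | succ k => rw [zk_succ, ← mul_assoc]; simp [AA, dl, aseq_x]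

theorem DD_bound (w : H) : ∃ K : ℝ, 0 ≤ K ∧ ∀ N : ℕ,
    |DD w N| ≤ K * ((N : ℝ) + 1) ^ (-(1 / 2) : ℝ) := by
  obtain ⟨K, hK, h⟩ := bound2 w
  refine ⟨K * ∑' m : ℕ, ((m : ℝ) + 1) ^ (-(5 / 4) : ℝ), ?_, fun N => ?_⟩
  · have : 0 ≤ ∑' m : ℕ, ((m : ℝ) + 1) ^ (-(5 / 4) : ℝ) := tsum_nonneg (fun m => by positivity)
    positivity
  · rw [DD, abs_neg]
    have := tsum_of_norm_bounded (summ54.mul_left (K * ((N : ℝ) + 1) ^ (-(1 / 2) : ℝ))).hasSum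
      (f := fun m : ℕ => dl (aseq w) N (m + 1) / ((m : ℝ) + 1)) (fun m => h N m)
    rw [tsum_mul_left] at this
    rw [Real.norm_eq_abs] at this
    linarith

theorem tend_pow (p : ℝ) (hp : 0 < p) (K : ℝ) :
    Filter.Tendsto (fun N : ℕ => K * ((N : ℝ) + 1) ^ (-p)) Filter.atTop (nhds 0) := by
  rw [← mul_zero K]
  apply Filter.Tendsto.const_mul
  apply (tendsto_rpow_neg_atTop hp).comp
  have : (fun m : ℕ => (m : ℝ) + 1) = fun m : ℕ => (((m + 1 : ℕ)) : ℝ) := by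
    funext m; push_cast; ring
  rw [this]
  exact tendsto_natCast_atTop_atTop.comp (Filter.tendsto_add_atTop_nat _)

theorem DD_lim (w : H) : Filter.Tendsto (DD w) Filter.atTop (nhds 0) := by
  obtain ⟨K, hK, h⟩ := DD_bound w
  exact squeeze_zero_norm h (tend_pow _ (by norm_num) K)

theorem AD_lim (u w : H) :
    Filter.Tendsto (fun N => AA u N * DD w N) Filter.atTop (nhds 0) := by
  obtain ⟨K, hK, h⟩ := DD_bound w
  obtain ⟨K', hK', h'⟩ := bound0 u
  refine squeeze_zero_norm (fun N => ?_) (tend_pow (1 / 4) (by norm_num) (K' * K))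
  rw [norm_mul]
  have hN : (0 : ℝ) < N + 1 := by positivity
  have e : ((N : ℝ) + 1) ^ (-(1 / 4) : ℝ) =
    ((N : ℝ) + 1) ^ (1 / 4 : ℝ) * ((N : ℝ) + 1) ^ (-(1 / 2) : ℝ) := by
    rw [← Real.rpow_add hN]; norm_num
  rw [e]
  calc _ ≤ (K' * ((N : ℝ) + 1) ^ (1 / 4 : ℝ)) * (K * ((N : ℝ) + 1) ^ (-(1 / 2) : ℝ)) :=
        mul_le_mul (h' N) (h N) (abs_nonneg _) (by positivity)
    _ = _ := by ring

def zw (l : List ℕ) : H := (l.map zk).prod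

theorem zw_nil : zw [] = 1 := rfl
theorem zw_cons (k : ℕ) (l : List ℕ) : zw (k :: l) = zk k * zw l := by simp [zw]
theorem zw_snoc (k : ℕ) (l : List ℕ) : zw (l ++ [k]) = zw l * zk k := by simp [zw]

theorem st_xpow (st : H →ₗ[ℚ] H →ₗ[ℚ] H) (hst : IsHarmonic st) (k : ℕ) (u v : H) : st (Hx ^ k * u) v = Hx ^ k * st u v := by
  induction k with
  | zero => simp
  | succ k ih => rw [pow_succ', mul_assoc, hst.2.2.1, ih, mul_assoc]

theorem st_xpow' (st : H →ₗ[ℚ] H →ₗ[ℚ] H) (hst : IsHarmonic st) (k : ℕ) (u v : H) : st u (Hx ^ k * v) = Hx ^ k * st u v := by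
  induction k with
  | zero => simp
  | succ k ih => rw [pow_succ', mul_assoc, hst.2.2.2.1, ih, mul_assoc]

theorem st_left (st : H →ₗ[ℚ] H →ₗ[ℚ] H) (hst : IsHarmonic st) (a b : ℕ) (u v : H) : st (zk a * u) (zk b * v) =
    zk a * st u (zk b * v) + zk b * st (zk a * u) v + zk (a + b + 1) * st u v := by
  have h := hst.2.2.2.2 (Hx ^ a * u) (Hx ^ b * v)
  simp only [← mul_assoc] at h
  simp only [zk]
  rw [h, mul_assoc Hy (Hx ^ b) v, st_xpow st hst, mul_assoc Hy (Hx ^ a) u, st_xpow' st hst,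
    st_xpow st hst, st_xpow' st hst]
  rw [show a + b + 1 = 1 + a + b by ring, pow_add, pow_add, pow_one]
  simp only [mul_add, mul_assoc]

theorem st_right (st : H →ₗ[ℚ] H →ₗ[ℚ] H) (hst : IsHarmonic st) (l1 l2 : List ℕ) (a b : ℕ) : st (zw l1 * zk a) (zw l2 * zk b) =
    st (zw l1) (zw l2 * zk b) * zk a + st (zw l1 * zk a) (zw l2) * zk b
      + st (zw l1) (zw l2) * zk (a + b + 1) := by
  induction l1 generalizing l2 with
  | nil =>
    induction l2 with
    | nil =>
      have h := st_left st hst a b 1 1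
      simp only [mul_one, zw_nil, one_mul, hst.1, hst.2.1] at h ⊢
      rw [h]; abel
    | cons c l2 ih =>
      have h1 := st_left st hst a c 1 (zw l2 * zk b)
      have h2 := st_left st hst a c 1 (zw l2)
      simp only [zw_nil, zw_cons, one_mul, mul_one, hst.2.1, mul_assoc] at ih h1 h2 ⊢
      rw [h1, h2, ih]; noncomm_ring
  | cons c l1 ih1 =>
    induction l2 with
    | nil =>
      have h1 := st_left st hst c b (zw l1 * zk a) 1
      have h2 := st_left st hst c b (zw l1) 1
      replace ih1 := ih1 []
      simp only [zw_nil, zw_cons, one_mul, mul_one, hst.1, mul_assoc] at ih1 h1 h2 ⊢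
      rw [h1, h2, ih1]; noncomm_ring
    | cons d l2 ih =>
      have h1 := st_left st hst c d (zw l1 * zk a) (zw l2 * zk b)
      have h2 := st_left st hst c d (zw l1) (zw l2 * zk b)
      have h3 := st_left st hst c d (zw l1 * zk a) (zw l2)
      have h4 := st_left st hst c d (zw l1) (zw l2)
      have h5 := ih1 (d :: l2)
      have h6 := ih1 l2
      simp only [zw_cons, mul_assoc] at ih h1 h2 h3 h4 h5 h6 ⊢
      rw [h1, h2, h3, h4, h5, h6, ih]; noncomm_ring

theorem BB_one (N : ℕ) : BB 1 N = 1 := by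
  have h : ∀ N m, dl (aseq 1) N (m + 1) = 0 := by
    intro N
    induction N with
    | zero => intro m; simp [dl, aseq_one, dlt]
    | succ N ih => intro m; rw [dl_succ, ih, ih, sub_zero]
  ext
  · simp only [BB_fst, AA, TrivSqZeroExt.fst_one]
    induction N with
    | zero => simp [dl, aseq_one, dlt]
    | succ N ih => rw [dl_succ, h, ih, sub_zero]
  · simp [DD, h]

theorem BB_mul (st : H →ₗ[ℚ] H →ₗ[ℚ] H) (hst : IsHarmonic st) (l1 l2 : List ℕ) :
    ∀ N : ℕ, BB (st (zw l1) (zw l2)) N = BB (zw l1) N * BB (zw l2) N := by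
  induction l1 using List.reverseRecOn generalizing l2 with
  | nil => intro N; rw [zw_nil, hst.2.1, BB_one, one_mul]
  | append_singleton l1 a ih1 =>
    induction l2 using List.reverseRecOn with
    | nil => intro N; rw [zw_nil, hst.1, BB_one, mul_one]
    | append_singleton l2 b ih2 =>
      have k1 := ih1 (l2 ++ [b])
      have k2 := ih1 l2
      simp only [zw_snoc] at ih2 k1 k2 ⊢
      set W := st (zw l1 * zk a) (zw l2 * zk b) with hW
      set E : ℕ → DualNumber ℝ := fun N => BB W N - BB (zw l1 * zk a) N * BB (zw l2 * zk b) N with hE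
      have hstep : ∀ N, E (N + 1) = E N := by
        intro N
        simp only [hE, hW]
        rw [st_right st hst]
        simp only [BB_add, BB_z, k1, k2, ih2]
        ring
      have hconst : ∀ N, E N = E 0 := by
        intro N
        induction N with
        | zero => rfl
        | succ N ih => rw [hstep, ih]
      have hW0 : AA W 0 = 0 := by
        rw [hW, st_right st hst]
        simp only [AA_add, AA_z_zero, add_zero]
      have hE0 : E 0 = 0 := by
        ext
        · simp [hE, hW0, AA_z_zero]
        · have h1 : ∀ N, DD W N - (AA (zw l1 * zk a) N * DD (zw l2 * zk b) N +
              AA (zw l2 * zk b) N * DD (zw l1 * zk a) N) = (E 0).snd := by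
            intro N
            rw [← hconst N]
            simp [hE]; ring
          have h2 := (DD_lim W).sub ((AD_lim (zw l1 * zk a) (zw l2 * zk b)).add
            (AD_lim (zw l2 * zk b) (zw l1 * zk a)))
          simp only [h1] at h2
          simpa using tendsto_nhds_unique tendsto_const_nhds h2
      intro N
      have := hconst N
      rw [hE0] at this
      exact sub_eq_zero.1 this

theorem DD_zero_mul (st : H →ₗ[ℚ] H →ₗ[ℚ] H) (hst : IsHarmonic st) (l1 l2 : List ℕ) (a b : ℕ) :
    DD (st (zw (l1 ++ [a])) (zw (l2 ++ [b]))) 0 = 0 := by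
  have h := congrArg TrivSqZeroExt.snd (BB_mul st hst (l1 ++ [a]) (l2 ++ [b]) 0)
  simp only [BB_snd, TrivSqZeroExt.snd_mul, BB_fst, zw_snoc, AA_z_zero] at h
  simpa [zw_snoc] using h

theorem y_span (p : H) : Hy * p ∈ Submodule.span ℚ {u : H | ∃ l k, u = zw (l ++ [k])} := by
  refine right_ind ((Submodule.span ℚ {u : H | ∃ l k, u = zw (l ++ [k])}).comap
    (LinearMap.mulLeft ℚ Hy)) ?_ ?_ ?_ p
  · refine Submodule.subset_span ⟨[], 0, ?_⟩
    simp [zw, zk]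
  · intro w hw
    simp only [Submodule.mem_comap, LinearMap.mulLeft_apply, ← mul_assoc] at hw ⊢
    generalize Hy * w = v at hw
    induction hw using Submodule.span_induction with
    | mem v hv =>
      obtain ⟨l, k, rfl⟩ := hv
      refine Submodule.subset_span ⟨l, k + 1, ?_⟩
      rw [zw_snoc, zw_snoc, zk_succ, mul_assoc]
    | zero => simp
    | add u v _ _ hu hv => rw [add_mul]; exact Submodule.add_mem _ hu hv
    | smul c v _ hv => rw [smul_mul_assoc]; exact Submodule.smul_mem _ _ hv
  · intro w hw
    simp only [Submodule.mem_comap, LinearMap.mulLeft_apply, ← mul_assoc] at hw ⊢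
    generalize Hy * w = v at hw
    induction hw using Submodule.span_induction with
    | mem v hv =>
      obtain ⟨l, k, rfl⟩ := hv
      refine Submodule.subset_span ⟨l ++ [k], 0, ?_⟩
      rw [zw_snoc _ (l ++ [k]), zk, pow_zero, mul_one]
    | zero => simp
    | add u v _ _ hu hv => rw [add_mul]; exact Submodule.add_mem _ hu hv
    | smul c v _ hv => rw [smul_mul_assoc]; exact Submodule.smul_mem _ _ hv

def DD0 : H →ₗ[ℚ] ℝ where
  toFun w := DD w 0
  map_add' u v := DD_add u v 0
  map_smul' c u := by simp [DD_smul, Rat.smul_def]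

theorem DD_zero_main (st : H →ₗ[ℚ] H →ₗ[ℚ] H) (hst : IsHarmonic st) (p q : H) :
    DD0 (st (Hy * p) (Hy * q)) = 0 := by
  have hp := y_span p
  have hq := y_span q
  generalize Hy * p = u at hp
  generalize Hy * q = v at hq
  induction hp using Submodule.span_induction with
  | zero => simp
  | add u u' _ _ hu hu' => simp [hu, hu']
  | smul c u _ hu => simp [hu]
  | mem u hu =>
    obtain ⟨l, a, rfl⟩ := hu
    induction hq using Submodule.span_induction with
    | zero => simp
    | add u u' _ _ hu hu' => simp [hu, hu']
    | smul c u _ hu => simp [hu]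
    | mem u hu =>
      obtain ⟨l', b, rfl⟩ := hu
      exact DD_zero_mul st hst l l' a b
theorem phi_x : phi Hx = Hx + Hy := by simp [phi, Hx]
theorem phi_y : phi Hy = -Hy := by simp [phi, Hy]
theorem phi_phi (w : H) : phi (phi w) = w := by
  have : phi.comp phi = AlgHom.id ℚ H := by
    apply FreeAlgebra.hom_ext
    funext b
    cases b
    · change phi (phi Hx) = Hx
      rw [phi_x, map_add, phi_x, phi_y]; abel
    · change phi (phi Hy) = Hy
      rw [phi_y, map_neg, phi_y, neg_neg]
  exact DFunLike.congr_fun this w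

def cc (v : H) (n : ℕ) : ℝ := aseq (phi v) n

theorem cc_y (v : H) (n : ℕ) : cc (v * Hy) n = (∑ m ∈ Finset.range n, cc v m) / n := by
  simp only [cc]
  rw [map_mul, phi_y, mul_neg, map_neg, Pi.neg_apply, aseq_y]; ring

theorem cc_x (v : H) (n : ℕ) (h0 : cc v 0 = 0) : cc (v * Hx) n = cc v n / n := by
  simp only [cc] at *
  rw [map_mul, phi_x, mul_add, map_add, Pi.add_apply, aseq_y, aseq_x, ← add_div]
  congr 1
  have h1 := Finset.sum_range_succ (aseq (phi v)) n
  have h2 := Finset.sum_range_succ' (aseq (phi v)) n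
  linarith

theorem cc_one (n : ℕ) : cc 1 n = dlt n := by simp [cc, aseq_one]

theorem cc_z (v : H) (k n : ℕ) :
    cc (v * zk k) n = (∑ m ∈ Finset.range n, cc v m) / (n : ℝ) ^ (k + 1) := by
  induction k generalizing n with
  | zero => simp [zk, cc_y]
  | succ k ih =>
    rw [zk_succ, ← mul_assoc, cc_x _ _ (by simp [ih]), ih, pow_succ (n : ℝ) (k + 1), div_div]

theorem cc_nonneg (l : List ℕ) (n : ℕ) : 0 ≤ cc (zw l) n := by
  induction l using List.reverseRecOn generalizing n with
  | nil => rw [zw_nil, cc_one, dlt]; split_ifs <;> norm_num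
  | append_singleton l k ih =>
    rw [zw_snoc, cc_z]
    have := Finset.sum_nonneg (fun m (_ : m ∈ Finset.range n) => ih m)
    positivity

open Classical in
def EE (r : ℕ) (k : Fin r → ℕ) (N : ℕ) : ENNReal :=
  ∑' n : Fin r → ℕ, if (∀ i, 0 < n i) ∧ StrictMono n ∧ (∀ i, n i < N) then
    ∏ i, ENNReal.ofReal (1 / (n i : ℝ) ^ (k i + 1)) else 0

theorem snoc_cond (r : ℕ) (P : ℕ → Prop) (m : ℕ) (n : Fin r → ℕ) :
    ((∀ i, 0 < (Fin.snoc n m : Fin (r + 1) → ℕ) i) ∧ StrictMono (Fin.snoc n m : Fin (r + 1) → ℕ) ∧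
      P ((Fin.snoc n m : Fin (r + 1) → ℕ) (Fin.last r))) ↔
    (0 < m ∧ P m) ∧ ((∀ i, 0 < n i) ∧ StrictMono n ∧ (∀ i, n i < m)) := by
  constructor
  · rintro ⟨h1, h2, h3⟩
    refine ⟨⟨by simpa using h1 (Fin.last r), by simpa using h3⟩,
      fun i => by simpa using h1 i.castSucc, fun i j hij => ?_, fun i => ?_⟩
    · simpa using h2 (Fin.castSucc_lt_castSucc_iff.2 hij)
    · simpa using h2 (Fin.castSucc_lt_last i)
  · rintro ⟨⟨h1, h2⟩, h3, h4, h5⟩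
    refine ⟨fun i => ?_, fun i j hij => ?_, by simpa using h2⟩
    · refine Fin.lastCases ?_ (fun i => ?_) i
      · simpa using h1
      · simpa using h3 i
    · induction j using Fin.lastCases with
      | last =>
        induction i using Fin.lastCases with
        | last => exact absurd hij (lt_irrefl _)
        | cast i => simpa using h5 i
      | cast j =>
        induction i using Fin.lastCases with
        | last => exact absurd hij (not_lt.2 (Fin.le_last _))
        | cast i => simpa using h4 (Fin.castSucc_lt_castSucc_iff.1 hij)

open Classical in
theorem snoc_sum (r : ℕ) (k : Fin (r + 1) → ℕ) (P : ℕ → Prop) :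
    (∑' n : Fin (r + 1) → ℕ, if (∀ i, 0 < n i) ∧ StrictMono n ∧ P (n (Fin.last r)) then
      ∏ i, ENNReal.ofReal (1 / (n i : ℝ) ^ (k i + 1)) else 0) =
    ∑' m : ℕ, if 0 < m ∧ P m then ENNReal.ofReal (1 / (m : ℝ) ^ (k (Fin.last r) + 1)) *
      EE r (fun i => k i.castSucc) m else 0 := by
  rw [← (Fin.snocEquiv (fun _ : Fin (r + 1) => ℕ)).tsum_eq, ENNReal.tsum_prod']
  refine tsum_congr (fun m => ?_)
  have e : ∀ n : Fin r → ℕ, (Fin.snocEquiv (fun _ : Fin (r + 1) => ℕ)) (m, n) =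
    (Fin.snoc n m : Fin (r + 1) → ℕ) := fun n => rfl
  simp only [e, snoc_cond]
  split_ifs with h
  · rw [EE, ← ENNReal.tsum_mul_left]
    refine tsum_congr (fun n => ?_)
    simp only [h, true_and, and_self]
    split_ifs with h'
    · rw [Fin.prod_univ_castSucc]
      simp [mul_comm]
    · simp
  · simp [h]

theorem zw_ofFn_succ (r : ℕ) (k : Fin (r + 1) → ℕ) :
    zw (List.ofFn k) = zw (List.ofFn fun i : Fin r => k i.castSucc) * zk (k (Fin.last r)) := by
  rw [List.ofFn_succ', List.concat_eq_append, zw_snoc]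

theorem term_eq (r : ℕ) (k : Fin (r + 1) → ℕ) (m : ℕ)
    (h : EE r (fun i => k i.castSucc) m = ENNReal.ofReal
      (∑ j ∈ Finset.range m, cc (zw (List.ofFn fun i : Fin r => k i.castSucc)) j)) :
    ENNReal.ofReal (1 / (m : ℝ) ^ (k (Fin.last r) + 1)) * EE r (fun i => k i.castSucc) m =
      ENNReal.ofReal (cc (zw (List.ofFn k)) m) := by
  rw [h, ← ENNReal.ofReal_mul (by positivity), zw_ofFn_succ, cc_z]
  congr 1
  ring

theorem cc_zero_succ (r : ℕ) (k : Fin (r + 1) → ℕ) : cc (zw (List.ofFn k)) 0 = 0 := by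
  rw [zw_ofFn_succ, cc_z]; simp

theorem EE_eq (r : ℕ) (k : Fin r → ℕ) (N : ℕ) (hN : 0 < N) :
    EE r k N = ENNReal.ofReal (∑ j ∈ Finset.range N, cc (zw (List.ofFn k)) j) := by
  classical
  induction r generalizing N with
  | zero =>
    have e : ∑ j ∈ Finset.range N, dlt j = 1 := by
      simp only [dlt]
      rw [Finset.sum_ite_eq' (Finset.range N) 0]; simp [hN]
    simp [EE, zw_nil, cc_one, e, StrictMono]
  | succ r ih =>
    have h1 : (∑' n : Fin (r + 1) → ℕ, if (∀ i, 0 < n i) ∧ StrictMono n ∧ (n (Fin.last r) < N) then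
        ∏ i, ENNReal.ofReal (1 / (n i : ℝ) ^ (k i + 1)) else 0) =
      ∑' m : ℕ, if 0 < m ∧ m < N then ENNReal.ofReal (1 / (m : ℝ) ^ (k (Fin.last r) + 1)) *
        EE r (fun i => k i.castSucc) m else 0 := by
      convert snoc_sum r k (fun m => m < N)
    have h2 : EE (r + 1) k N = ∑' n : Fin (r + 1) → ℕ,
        if (∀ i, 0 < n i) ∧ StrictMono n ∧ (n (Fin.last r) < N) then
        ∏ i, ENNReal.ofReal (1 / (n i : ℝ) ^ (k i + 1)) else 0 := by
      rw [EE]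
      refine tsum_congr (fun n => ?_)
      congr 1
      refine propext (and_congr_right fun _ => and_congr_right fun hs => ⟨fun h => h _, fun h i => ?_⟩)
      exact (hs.monotone (Fin.le_last i)).trans_lt h
    rw [h2, h1, ENNReal.ofReal_sum_of_nonneg (fun i _ => cc_nonneg _ _)]
    rw [tsum_eq_sum (s := Finset.range N)]
    · refine Finset.sum_congr rfl (fun m hm => ?_)
      rw [Finset.mem_range] at hm
      rcases Nat.eq_zero_or_pos m with rfl | h0
      · rw [cc_zero_succ]; simp
      · rw [if_pos ⟨h0, hm⟩]
        exact term_eq r k m (ih _ m h0)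
    · intro m hm
      rw [Finset.mem_range] at hm
      simp [hm]

theorem MZV_eq (r : ℕ) (k : Fin (r + 1) → ℕ) :
    MZV (r + 1) (fun i => k i + 1) = ∑' m : ℕ, cc (zw (List.ofFn k)) m := by
  classical
  have h1 : (∑' n : Fin (r + 1) → ℕ, if (∀ i, 0 < n i) ∧ StrictMono n ∧ True then
        ∏ i, ENNReal.ofReal (1 / (n i : ℝ) ^ (k i + 1)) else 0) =
      ∑' m : ℕ, if 0 < m ∧ True then ENNReal.ofReal (1 / (m : ℝ) ^ (k (Fin.last r) + 1)) *
        EE r (fun i => k i.castSucc) m else 0 := by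
      convert snoc_sum r k (fun _ => True)
  have h2 : (∑' m : ℕ, if 0 < m ∧ True then ENNReal.ofReal (1 / (m : ℝ) ^ (k (Fin.last r) + 1)) *
      EE r (fun i => k i.castSucc) m else 0) = ∑' m : ℕ, ENNReal.ofReal (cc (zw (List.ofFn k)) m) := by
    refine tsum_congr (fun m => ?_)
    rcases Nat.eq_zero_or_pos m with rfl | h0
    · rw [cc_zero_succ]; simp
    · rw [if_pos ⟨h0, trivial⟩]
      exact term_eq r k m (EE_eq r _ m h0)
  have h3 : (∑' m : ℕ, cc (zw (List.ofFn k)) m) =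
      (∑' m : ℕ, ENNReal.ofReal (cc (zw (List.ofFn k)) m)).toReal := by
    rw [ENNReal.tsum_toReal_eq (fun _ => ENNReal.ofReal_ne_top)]
    exact tsum_congr (fun m => (ENNReal.toReal_ofReal (cc_nonneg _ _)).symm)
  rw [h3, ← h2, ← h1]
  have h4 := tsum_subtype {n : Fin (r + 1) → ℕ | (∀ i, 0 < n i) ∧ StrictMono n}
    (fun n => ∏ i, ENNReal.ofReal (1 / (n i : ℝ) ^ (k i + 1)))
  have h5 : (∑' n : Fin (r + 1) → ℕ, if (∀ i, 0 < n i) ∧ StrictMono n ∧ True then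
      ∏ i, ENNReal.ofReal (1 / (n i : ℝ) ^ (k i + 1)) else 0) =
      ∑' n : {n : Fin (r + 1) → ℕ // (∀ i, 0 < n i) ∧ StrictMono n},
        ∏ i, ENNReal.ofReal (1 / (n.1 i : ℝ) ^ (k i + 1)) := by
    refine Eq.trans ?_ h4.symm
    refine tsum_congr (fun n => ?_)
    simp [Set.indicator]
  rw [h5, ENNReal.tsum_toReal_eq]
  · rw [MZV]
    refine tsum_congr (fun n => ?_)
    rw [ENNReal.toReal_prod]
    exact Finset.prod_congr rfl (fun i _ => (ENNReal.toReal_ofReal (by positivity)).symm)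
  · intro n
    exact ENNReal.prod_ne_top (fun i _ => ENNReal.ofReal_ne_top)

theorem Z_zw (Z : H →ₗ[ℚ] ℝ) (hZ : IsZetaMap Z) (l : List ℕ) (k : ℕ) :
    Z (zw (l ++ [k]) * Hx) = -DD0 (phi (zw (l ++ [k]))) := by
  set K : Fin (l.length + 1) → ℕ := Fin.snoc l.get (k + 1) with hK
  have e1 : List.ofFn K = l ++ [k + 1] := by
    rw [List.ofFn_succ', List.concat_eq_append]
    simp [hK]
  have e2 : zw (l ++ [k]) * Hx = zw (List.ofFn K) := by
    rw [e1, zw_snoc, zw_snoc, zk_succ, mul_assoc]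
  have h := hZ l.length (fun i => K i + 1) (fun i => by omega) (by simp [hK])
  have e3 : (List.ofFn fun i => Hy * Hx ^ (K i + 1 - 1)).prod = zw (List.ofFn K) := by
    rw [zw, List.map_ofFn]; rfl
  rw [e3, MZV_eq, ← e2] at h
  rw [h]
  have h0 : cc (zw (l ++ [k])) 0 = 0 := by rw [zw_snoc, cc_z]; simp
  have hs := summ1 (phi (zw (l ++ [k]))) 0
  have hterm : ∀ m : ℕ, cc (zw (l ++ [k]) * Hx) (m + 1) =
      dl (aseq (phi (zw (l ++ [k])))) 0 (m + 1) / ((m : ℝ) + 1) := by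
    intro m
    rw [cc_x _ _ h0]; push_cast; rfl
  have hs2 : Summable (fun m => cc (zw (l ++ [k]) * Hx) m) := by
    rw [← summable_nat_add_iff 1]
    exact hs.congr (fun m => (hterm m).symm)
  rw [hs2.tsum_eq_zero_add, tsum_congr hterm, cc_x _ _ h0, h0]
  simp [DD0, DD]

theorem Z_y (Z : H →ₗ[ℚ] ℝ) (hZ : IsZetaMap Z) (p : H) :
    Z (Hy * p * Hx) = -DD0 (phi (Hy * p)) := by
  have hp := y_span p
  generalize Hy * p = u at hp
  induction hp using Submodule.span_induction with
  | zero => simp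
  | add u v _ _ hu hv => rw [add_mul, map_add, hu, hv, map_add, map_add]; ring
  | smul c u _ hu => rw [smul_mul_assoc, map_smul, hu, map_smul, map_smul, smul_neg]
  | mem u hu =>
    obtain ⟨l, k, rfl⟩ := hu
    exact Z_zw Z hZ l k

/-- Linear part of Kawashima's relation. For all `w₁, w₂ ∈ yℌ`,
`Z(φ(w₁ ∗ w₂) x) = 0`. -/
theorem statement14 (Z : H →ₗ[ℚ] ℝ) (hZ : IsZetaMap Z)
    (st : H →ₗ[ℚ] H →ₗ[ℚ] H) (hst : IsHarmonic st) (p q : H) :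
    Z (phi (st (Hy * p) (Hy * q)) * Hx) = 0 := by
  have h0 := DD_zero_main st hst p q
  rw [hst.2.2.2.2] at h0 ⊢
  generalize st p (Hy * q) + st (Hy * p) q + Hx * st p q = r at h0 ⊢
  have e : phi (Hy * r) = Hy * (-phi r) := by
    rw [map_mul, phi_y, neg_mul, mul_neg]
  rw [e, Z_y Z hZ, ← e, phi_phi, h0, neg_zero]

end
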